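/- Let S be a continuous bundle RDS on G, let R = {R} and Q = {Q} be two finite measurable partitions of G, and μ ∈ P_P(G). Then H_μ(R | 𝔔 ∨ F_G) ≤ ∫ log N(R | Q)(ω) dP(ω), where 𝔔 is the sub-σ-algebra generated by Q and F_G = {(F×Y)∩G : F ∈ F}. -/

import Mathlib

open MeasureTheory Set Filter Topology
open scoped ENNReal

namespace RelTail

variable {Ω W : Type*}

/-- The fiber over `ω` of a subset of a product space. -/
def fib (E : Set (Ω × W)) (ω : Ω) : Set W := {x | (ω, x) ∈ E}

/-- Minimal cardinality of a subfamily of the cover `R` whose fibers at `ω` cover the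
fiber of `S` at `ω` (with the convention that the empty set needs one element). -/
noncomputable def coverNum (S : Set (Ω × W)) (R : Set (Set (Ω × W))) (ω : Ω) : ℕ :=
  max 1 (sInf {n : ℕ | ∃ F : Finset (Set (Ω × W)), ↑F ⊆ R ∧ F.card = n ∧
    fib S ω ⊆ ⋃ u ∈ F, fib u ω})

/-- `N(R | Q)(ω) = max_{q ∈ Q} N(q, R)(ω)`. -/
noncomputable def relCoverNum (R Q : Set (Set (Ω × W))) (ω : Ω) : ℕ :=
  ⨆ q ∈ Q, coverNum q R ω

section Meas
variable [MeasurableSpace Ω] [MeasurableSpace W]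

/-- A (finite or countable) random cover of `E`. -/
def IsRandomCover (E : Set (Ω × W)) (Q : Set (Set (Ω × W))) : Prop :=
  Q.Countable ∧ (∀ q ∈ Q, MeasurableSet q) ∧ (∀ q ∈ Q, q ⊆ E) ∧
    ∀ ω, fib E ω ⊆ ⋃ q ∈ Q, fib q ω

/-- An open random cover: a random cover whose fibers are (a.e.) open in the fibers of `E`. -/
def IsOpenRandomCover [TopologicalSpace W] (P : Measure Ω) (E : Set (Ω × W))
    (Q : Set (Set (Ω × W))) : Prop :=
  IsRandomCover E Q ∧
    ∀ q ∈ Q, ∀ᵐ ω ∂P, ∃ U : Set W, IsOpen U ∧ fib q ω = U ∩ fib E ω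

end Meas

/-- The join `⋁_{i<n} (Γ^i)^{-1} Q` of a cover (or partition). -/
def iterJoin {Z : Type*} (Γ : Z → Z) (Q : Set (Set Z)) (n : ℕ) : Set (Set Z) :=
  {s | ∃ f : ℕ → Set Z, (∀ i, f i ∈ Q) ∧ s = ⋂ i ∈ Finset.range n, (Γ^[i]) ⁻¹' (f i)}

/-- `log N(R^{(n)} | Q^{(n)})(ω)`. -/
noncomputable def iterCoverLog (Θ : Ω × W → Ω × W) (R Q : Set (Set (Ω × W))) (n : ℕ)
    (ω : Ω) : ℝ :=
  Real.log (relCoverNum (iterJoin Θ R n) (iterJoin Θ Q n) ω)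

/-- The relative tail entropy `h_Θ(R|Q)` of an open random cover `R` w.r.t. a random
cover `Q`, as a limit (limsup) of `(1/n) ∫ log N(R^{(n)}|Q^{(n)}) dP`. -/
noncomputable def relCoverEnt [MeasurableSpace Ω] (P : Measure Ω) (Θ : Ω × W → Ω × W)
    (R Q : Set (Set (Ω × W))) : ℝ≥0∞ :=
  Filter.atTop.limsup fun n : ℕ => ENNReal.ofReal ((∫ ω, iterCoverLog Θ R Q n ω ∂P) / n)

/-- `h(Θ|Q)`: supremum over all open random covers `R` of `h_Θ(R|Q)`. -/
noncomputable def condTailEnt [MeasurableSpace Ω] [MeasurableSpace W] [TopologicalSpace W]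
    (P : Measure Ω) (E : Set (Ω × W)) (Θ : Ω × W → Ω × W) (Q : Set (Set (Ω × W))) : ℝ≥0∞ :=
  ⨆ R ∈ {R | IsOpenRandomCover P E R}, relCoverEnt P Θ R Q

/-- The relative tail entropy `h*(Θ)`: infimum over all random covers `Q` of `h(Θ|Q)`. -/
noncomputable def tailEnt [MeasurableSpace Ω] [MeasurableSpace W] [TopologicalSpace W]
    (P : Measure Ω) (E : Set (Ω × W)) (Θ : Ω × W → Ω × W) : ℝ≥0∞ :=
  ⨅ Q ∈ {Q | IsRandomCover E Q}, condTailEnt P E Θ Q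

/-- The skew product transformation of a bundle RDS. -/
def skew (ϑ : Ω → Ω) (T : Ω → W → W) : Ω × W → Ω × W := fun p => (ϑ p.1, T p.1 p.2)

/-- A continuous bundle random dynamical system over `(Ω, P, ϑ)` on `E`. -/
structure IsBundleRDS [MeasurableSpace Ω] [MeasurableSpace W] [TopologicalSpace W]
    (P : Measure Ω) (ϑ : Ω → Ω) (E : Set (Ω × W)) (T : Ω → W → W) : Prop where
  measurePreserving : MeasurePreserving ϑ P P
  measurable : Measurable fun p : Ω × W => T p.1 p.2
  mapsTo : ∀ ω, MapsTo (T ω) (fib E ω) (fib E (ϑ ω))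
  continuousOn : ∀ᵐ ω ∂P, ContinuousOn (T ω) (fib E ω)

/-- A finite or countable measurable partition of a set `E`. -/
def IsCountablePartition {Z : Type*} [MeasurableSpace Z] (E : Set Z) (R : Set (Set Z)) : Prop :=
  R.Countable ∧ (∀ s ∈ R, MeasurableSet s) ∧ (∀ s ∈ R, s ⊆ E) ∧
    R.PairwiseDisjoint id ∧ ⋃₀ R = E

/-- The conditional entropy `H_μ(R | m)` of a countable partition `R` given a
sub-σ-algebra `m`, via conditional expectations. -/
noncomputable def partCondEntropy {Z : Type*} (m : MeasurableSpace Z) [MeasurableSpace Z]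
    (μ : Measure Z) (R : Set (Set Z)) : ℝ≥0∞ :=
  ∑' r : R, ENNReal.ofReal
    (∫ z, Real.negMulLog ((μ[(r : Set Z).indicator (fun _ => (1 : ℝ)) | m]) z) ∂μ)

/-- The relative entropy `h_μ(R | m)` of the transformation `Γ` with respect to a
partition `R`, given the sub-σ-algebra `m`. -/
noncomputable def relEntPart {Z : Type*} (m : MeasurableSpace Z) [MeasurableSpace Z]
    (μ : Measure Z) (Γ : Z → Z) (R : Set (Set Z)) : ℝ≥0∞ :=
  Filter.atTop.limsup fun n : ℕ => partCondEntropy m μ (iterJoin Γ R n) / (n : ℝ≥0∞)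

/-- The relative entropy `h_μ(Γ | m)` given the sub-σ-algebra `m`: supremum over all
countable measurable partitions of `E` of finite conditional entropy. -/
noncomputable def relEnt {Z : Type*} (m : MeasurableSpace Z) [MeasurableSpace Z]
    (μ : Measure Z) (Γ : Z → Z) (E : Set Z) : ℝ≥0∞ :=
  ⨆ R ∈ {R | IsCountablePartition E R ∧ partCondEntropy m μ R ≠ ∞}, relEntPart m μ Γ R

/-- The fiberwise boundary `{(ω,x) : x ∈ ∂(R(ω))}` of a subset of a product space. -/
def fibFrontier [TopologicalSpace W] (R : Set (Ω × W)) : Set (Ω × W) :=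
  {p | p.2 ∈ frontier (fib R p.1)}

/-- The sub-σ-algebra of `Ω × W₁ × W₂` generated by the first two coordinates,
i.e. the σ-algebra `{(A × W₂) ∩ ⬝ : A ∈ F × B}`. -/
def firstPairSigma (Ω W₁ W₂ : Type*) [MeasurableSpace Ω] [MeasurableSpace W₁] :
    MeasurableSpace (Ω × W₁ × W₂) :=
  MeasurableSpace.comap (fun p : Ω × W₁ × W₂ => (p.1, p.2.1)) inferInstance

/-- The defect of upper semi-continuity of `f` at `m` relative to the set `S`. -/
noncomputable def uscDefect {M : Type*} [TopologicalSpace M] (f : M → ℝ≥0∞) (S : Set M)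
    (m : M) : ℝ≥0∞ :=
  if f m ≠ ∞ then Filter.limsup f (𝓝[S] m) - f m else ∞

/-- The factor (extension) transformation `(ω, y) ↦ (ω, π_ω y)`. -/
def factorMap {Y X : Type*} (πf : Ω → Y → X) : Ω × Y → Ω × X :=
  fun p => (p.1, πf p.1 p.2)

/-- `T` on `E` is a factor of `S` on `G` via the family `π_ω`. -/
structure IsFactor {Ω X Y : Type*} [MeasurableSpace Ω] [MeasurableSpace X] [MeasurableSpace Y]
    [TopologicalSpace X] [TopologicalSpace Y] (ϑ : Ω → Ω) (E : Set (Ω × X)) (G : Set (Ω × Y))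
    (T : Ω → X → X) (S : Ω → Y → Y) (πf : Ω → Y → X) : Prop where
  measurable : Measurable fun p : Ω × Y => πf p.1 p.2
  mapsTo : ∀ ω, MapsTo (πf ω) (fib G ω) (fib E ω)
  surjOn : ∀ ω, SurjOn (πf ω) (fib G ω) (fib E ω)
  continuousOn : ∀ ω, ContinuousOn (πf ω) (fib G ω)
  semiconj : ∀ ω, ∀ y ∈ fib G ω, πf (ϑ ω) (S ω y) = T ω (πf ω y)

theorem range_approx {X : Type*} [TopologicalSpace X] [PolishSpace X]
    [MeasurableSpace X] [BorelSpace X] (ν : Measure X) [IsFiniteMeasure ν]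
    (g : (ℕ → ℕ) → X) (hg : Continuous g) (c : ℝ≥0∞) (hc : c < ν (range g)) :
    ∃ K, IsCompact K ∧ K ⊆ range g ∧ c ≤ ν K := by
  have step : ∀ (k : ℕ) (s : Set (ℕ → ℕ)), ∃ n : ℕ, c < ν (g '' s) →
      c < ν (g '' (s ∩ {x | x k ≤ n})) := by
    intro k s
    by_cases h : c < ν (g '' s)
    · have hmono : Monotone fun n : ℕ => g '' (s ∩ {x | x k ≤ n}) := by
        intro n m hnm
        apply image_mono
        rintro x ⟨hx, hx'⟩
        exact ⟨hx, le_trans hx' hnm⟩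
      have hU : g '' s = ⋃ n : ℕ, g '' (s ∩ {x | x k ≤ n}) := by
        rw [← image_iUnion]
        congr 1
        ext x
        simp only [mem_iUnion, mem_inter_iff, mem_ofPred_eq]
        exact ⟨fun hx => ⟨x k, hx, le_rfl⟩, fun ⟨_, hx, _⟩ => hx⟩
      rw [hU, hmono.measure_iUnion] at h
      obtain ⟨n, hn⟩ := lt_iSup_iff.1 h
      exact ⟨n, fun _ => hn⟩
    · exact ⟨0, fun h' => absurd h' h⟩
  choose n hn using step
  let S : ℕ → Set (ℕ → ℕ) := fun k => Nat.rec univ (fun k s => s ∩ {x | x k ≤ n k s}) k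
  have S0 : S 0 = univ := rfl
  have S1 : ∀ k, S (k+1) = S k ∩ {x | x k ≤ n k (S k)} := fun k => rfl
  clear_value S
  have hS : ∀ k, c < ν (g '' S k) := by
    intro k
    induction k with
    | zero => rw [S0, image_univ]; exact hc
    | succ k ih => rw [S1]; exact hn _ _ ih
  have hSm : ∀ k, ∀ x ∈ S k, ∀ i < k, x i ≤ n i (S i) := by
    intro k
    induction k with
    | zero => intro x _ i hi; omega
    | succ k ih =>
      intro x hx i hi
      rw [S1] at hx
      rcases Nat.lt_succ_iff_lt_or_eq.1 hi with h | h
      · exact ih x hx.1 i h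
      · subst h; exact hx.2
  let K : Set (ℕ → ℕ) := Set.pi univ fun i => Iic (n i (S i))
  have hK : IsCompact K := isCompact_univ_pi fun i => (finite_Iic _).isCompact
  refine ⟨g '' K, hK.image hg, image_subset_range _ _, ?_⟩
  letI := TopologicalSpace.upgradeIsCompletelyMetrizable X
  rw [Set.measure_eq_iInf_isOpen (g '' K) ν]
  refine le_iInf fun U => le_iInf fun hKU => le_iInf fun hU => ?_
  by_contra hlt
  have hne : ∀ k, ∃ x ∈ S k, g x ∉ U := by
    intro k
    by_contra! h
    exact hlt ((hS k).le.trans (measure_mono (by rintro _ ⟨x, hx, rfl⟩; exact h x hx)))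
  choose x hx hxU using hne
  have hy : ∀ k, (fun i => min (x k i) (n i (S i))) ∈ K := fun k i _ => mem_Iic.2 (min_le_right _ _)
  obtain ⟨y, hyK, φ, hφ, hlim⟩ := hK.tendsto_subseq hy
  have hlim' : Tendsto (fun k => x (φ k)) atTop (𝓝 y) := by
    rw [tendsto_pi_nhds] at hlim ⊢
    intro i
    refine (hlim i).congr' ?_
    filter_upwards [eventually_gt_atTop i] with k hk
    exact min_eq_left (hSm _ _ (hx (φ k)) i (lt_of_lt_of_le hk (hφ.id_le k)))
  have hcl : IsClosed (g ⁻¹' Uᶜ) := hU.isClosed_compl.preimage hg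
  exact hcl.mem_of_tendsto hlim' (Eventually.of_forall fun k => hxU _) (hKU ⟨y, hyK, rfl⟩)

theorem analytic_null {X : Type*} [TopologicalSpace X] [PolishSpace X]
    [MeasurableSpace X] [BorelSpace X] (ν : Measure X) [IsFiniteMeasure ν]
    (A : Set X) (hA : AnalyticSet A) : NullMeasurableSet A ν := by
  rw [AnalyticSet] at hA
  rcases hA with rfl | ⟨g, hg, rfl⟩
  · exact MeasurableSet.empty.nullMeasurableSet
  by_cases h0 : ν (range g) = 0
  · exact NullMeasurableSet.of_null h0
  obtain ⟨u, -, hu, hulim⟩ := exists_seq_strictMono_tendsto' (pos_iff_ne_zero.2 h0)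
  choose K hK hKs hKc using fun k => range_approx ν g hg (u k) (hu k).2
  have hm : MeasurableSet (⋃ k, K k) := .iUnion fun k => (hK k).measurableSet
  refine hm.nullMeasurableSet.congr ?_
  refine ae_eq_of_subset_of_measure_ge (iUnion_subset hKs) ?_ hm.nullMeasurableSet
    (measure_ne_top _ _)
  exact le_of_tendsto' hulim fun k => (hKc k).trans (measure_mono (subset_iUnion K k))

theorem comap_mapNatBool (Ω : Type*) [mΩ : MeasurableSpace Ω] [MeasurableSpace.CountablyGenerated Ω] :
    mΩ = MeasurableSpace.comap (MeasurableSpace.mapNatBool Ω) inferInstance := by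
  apply le_antisymm
  · conv_lhs => rw [← MeasurableSpace.generateFrom_natGeneratingSequence Ω]
    apply MeasurableSpace.generateFrom_le
    rintro _ ⟨k, rfl⟩
    refine ⟨(fun x : ℕ → Bool => x k) ⁻¹' {true}, measurable_pi_apply k (.singleton _), ?_⟩
    ext ω
    simp [MeasurableSpace.mapNatBool]
  · exact (MeasurableSpace.measurable_mapNatBool Ω).comap_le

theorem proj_meas {Ω Y : Type*} [mΩ : MeasurableSpace Ω] [MeasurableSpace.CountablyGenerated Ω]
    [MetricSpace Y] [CompactSpace Y] [MeasurableSpace Y] [BorelSpace Y]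
    (P : Measure Ω) [IsFiniteMeasure P] (hP : P.IsComplete)
    (B : Set (Ω × Y)) (hB : MeasurableSet B) : MeasurableSet {ω | (fib B ω).Nonempty} := by
  have hprod : (inferInstance : MeasurableSpace (Ω × Y)) =
      MeasurableSpace.comap (Prod.map (MeasurableSpace.mapNatBool Ω) id) inferInstance := by
    show Prod.instMeasurableSpace = MeasurableSpace.comap _ Prod.instMeasurableSpace
    unfold Prod.instMeasurableSpace
    rw [MeasurableSpace.comap_prodMap]
    rw [← comap_mapNatBool, MeasurableSpace.comap_id]
  have hB' := hB
  rw [show (Prod.instMeasurableSpace : MeasurableSpace (Ω × Y)) = _ from hprod] at hB'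
  obtain ⟨B', hB'm, rfl⟩ := hB'
  have : PolishSpace Bool := { toSecondCountableTopology := inferInstance, toIsCompletelyMetrizableSpace := inferInstance }
  have : PolishSpace (ℕ → Bool) := inferInstance
  have : PolishSpace Y := { toSecondCountableTopology := inferInstance, toIsCompletelyMetrizableSpace := inferInstance }
  have hA : AnalyticSet (Prod.fst '' B') :=
    (hB'm.analyticSet).image_of_continuous continuous_fst
  have hn := analytic_null (P.map (MeasurableSpace.mapNatBool Ω)) _ hA
  have hq := hn.preimage ((MeasurableSpace.measurable_mapNatBool Ω).measurePreserving P).quasiMeasurePreserving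
  have := hq.measurable_of_complete
  convert this using 1
  ext ω
  constructor
  · rintro ⟨y, hy⟩
    exact ⟨_, hy, rfl⟩
  · rintro ⟨⟨x, y⟩, hy, hxy⟩
    refine ⟨y, ?_⟩
    simp only at hxy
    subst hxy
    exact hy

theorem entropy_le {ι : Type*} (s : Finset ι) (p : ι → ℝ) (hp : ∀ i ∈ s, 0 ≤ p i)
    (hsum : ∑ i ∈ s, p i = 1) (N : ℕ) (t : Finset ι) (hts : t ⊆ s) (htN : t.card ≤ N)
    (hN : 1 ≤ N) (ht : ∀ i ∈ s, i ∉ t → p i = 0) :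
    ∑ i ∈ s, Real.negMulLog (p i) ≤ Real.log N := by
  have hN' : (0 : ℝ) < N := by exact_mod_cast hN
  have e1 : ∑ i ∈ t, Real.negMulLog (p i) = ∑ i ∈ s, Real.negMulLog (p i) :=
    Finset.sum_subset hts fun i hi hi' => by rw [ht i hi hi', Real.negMulLog_zero]
  have e2 : ∑ i ∈ t, p i = 1 := by
    rw [← hsum]; exact Finset.sum_subset hts fun i hi hi' => ht i hi hi'
  have key : ∀ i ∈ t, Real.negMulLog (p i) ≤ p i * Real.log N + (1 / N - p i) := by
    intro i hi
    rcases (hp i (hts hi)).eq_or_lt with h | h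
    · rw [← h]; simp
    · have := Real.log_le_sub_one_of_pos (show 0 < 1 / (p i * N) by positivity)
      rw [Real.log_div one_ne_zero (by positivity), Real.log_one,
        Real.log_mul h.ne' hN'.ne'] at this
      have h2 := mul_le_mul_of_nonneg_left this h.le
      have h3 : p i * (1 / (p i * N) - 1) = 1 / N - p i := by field_simp
      rw [h3] at h2
      unfold Real.negMulLog
      linarith
  rw [← e1]
  refine (Finset.sum_le_sum key).trans ?_
  rw [Finset.sum_add_distrib, ← Finset.sum_mul, e2, Finset.sum_sub_distrib, e2]
  simp only [Finset.sum_const, nsmul_eq_mul]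
  have : (t.card : ℝ) * (1 / N) ≤ 1 := by
    rw [mul_one_div, div_le_one hN']; exact_mod_cast htN
  linarith

/-- The members of `R` meeting `q` over `ω`. -/
def meet {Ω Y : Type*} (R : Set (Set (Ω × Y))) (q : Set (Ω × Y)) (ω : Ω) : Set (Set (Ω × Y)) :=
  {r ∈ R | (fib (q ∩ r) ω).Nonempty}

theorem coverNum_eq {Ω Y : Type*} (G : Set (Ω × Y)) (R : Set (Set (Ω × Y))) (hRf : R.Finite)
    (hd : R.PairwiseDisjoint id) (hU : ⋃₀ R = G) (q : Set (Ω × Y)) (hq : q ⊆ G) (ω : Ω) :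
    coverNum q R ω = max 1 (meet R q ω).ncard := by
  have hfin : (meet R q ω).Finite := hRf.subset fun r hr => hr.1
  unfold coverNum
  congr 1
  apply IsLeast.csInf_eq
  constructor
  · refine ⟨hfin.toFinset, ?_, ?_, ?_⟩
    · intro r hr
      simp only [Set.Finite.coe_toFinset] at hr
      exact hr.1
    · rw [Set.ncard_eq_toFinset_card _ hfin]
    · intro y hy
      have : (ω, y) ∈ ⋃₀ R := hU ▸ hq hy
      obtain ⟨r, hr, hry⟩ := this
      refine mem_iUnion₂.2 ⟨r, ?_, hry⟩
      rw [Set.Finite.mem_toFinset]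
      exact ⟨hr, y, hy, hry⟩
  · rintro n ⟨F, hFR, rfl, hF⟩
    rw [← Set.ncard_coe_finset]
    refine Set.ncard_le_ncard ?_ F.finite_toSet
    rintro r ⟨hr, y, hyq, hyr⟩
    obtain ⟨u, hu, hyu⟩ := mem_iUnion₂.1 (hF hyq)
    have : r = u := hd.elim hr (hFR hu) (Set.not_disjoint_iff.2 ⟨(ω, y), hyr, hyu⟩)
    rw [this]; exact hu

theorem bdd_aux {α : Type*} (Q : Set α) (f : α → ℕ) (C : ℕ) (hC : ∀ q ∈ Q, f q ≤ C) (q : α) :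
    (⨆ _ : q ∈ Q, f q) ≤ C := by
  by_cases h : q ∈ Q
  · simp [h, hC q h]
  · simp [h]

theorem le_relCoverNum {Ω Y : Type*} (R Q : Set (Set (Ω × Y))) (ω : Ω) (C : ℕ)
    (hC : ∀ q ∈ Q, coverNum q R ω ≤ C) (q : Set (Ω × Y)) (hq : q ∈ Q) :
    coverNum q R ω ≤ relCoverNum R Q ω := by
  unfold relCoverNum
  have h1 : coverNum q R ω = ⨆ _ : q ∈ Q, coverNum q R ω := by simp [hq]
  rw [h1]
  refine le_ciSup (f := fun q => ⨆ _ : q ∈ Q, coverNum q R ω) ⟨C, ?_⟩ q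
  rintro _ ⟨q', rfl⟩
  exact bdd_aux Q (fun q => coverNum q R ω) C hC q'

theorem relCoverNum_le {Ω Y : Type*} (R Q : Set (Set (Ω × Y))) (ω : Ω) (C : ℕ)
    (hC : ∀ q ∈ Q, coverNum q R ω ≤ C) : relCoverNum R Q ω ≤ C :=
  ciSup_le fun q' => bdd_aux Q (fun q => coverNum q R ω) C hC q'

theorem relCoverNum_meas {Ω Y : Type*} [MeasurableSpace Ω] (G : Set (Ω × Y))
    (R Q : Set (Set (Ω × Y))) (hRf : R.Finite) (hQf : Q.Finite)
    (hd : R.PairwiseDisjoint id) (hU : ⋃₀ R = G) (hQ : ∀ q ∈ Q, q ⊆ G)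
    (hm : ∀ q ∈ Q, ∀ r ∈ R, MeasurableSet {ω | (fib (q ∩ r) ω).Nonempty}) :
    Measurable fun ω => relCoverNum R Q ω := by
  have := hRf.to_subtype
  have := hQf.to_subtype
  let c : Ω → (Q × R → Prop) := fun ω x => (fib (x.1.1 ∩ x.2.1) ω).Nonempty
  have hc : Measurable c := measurable_pi_iff.2 fun x =>
    measurableSet_setOf.1 (hm _ x.1.2 _ x.2.2)
  let Φ : (Q × R → Prop) → ℕ := fun d =>
    ⨆ q : Set (Ω × Y), ⨆ hq : q ∈ Q, max 1 ({r | ∃ hr : r ∈ R, d (⟨q, hq⟩, ⟨r, hr⟩)}).ncard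
  have hΦ : (fun ω => relCoverNum R Q ω) = Φ ∘ c := by
    funext ω
    simp only [Φ, Function.comp, relCoverNum]
    congr 1; funext q; congr 1; funext hq
    rw [coverNum_eq G R hRf hd hU q (hQ q hq)]
    congr 2
    ext r
    simp [meet, c]
  rw [hΦ]
  exact (measurable_of_finite Φ).comp hc

/-- `H_μ(R | 𝔔 ∨ F_G) ≤ ∫ log N(R|Q)(ω) dP(ω)` for finite measurable
partitions `R`, `Q` of `G`. -/
theorem condEntropy_le_integral_log_coverNum
    {Ω Y : Type*} [MeasurableSpace Ω] [MeasurableSpace.CountablyGenerated Ω]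
    [MetricSpace Y] [CompactSpace Y] [MeasurableSpace Y] [BorelSpace Y]
    (P : Measure Ω) [IsProbabilityMeasure P] (hP : P.IsComplete)
    (ϑ : Ω → Ω) (G : Set (Ω × Y)) (hG : MeasurableSet G) (hGc : ∀ ω, IsCompact (fib G ω))
    (S : Ω → Y → Y) (hS : IsBundleRDS P ϑ G S)
    (μ : Measure (Ω × Y)) (hμp : IsProbabilityMeasure μ)
    (hμP : μ.map Prod.fst = P) (hμG : μ G = 1)
    (R Q : Set (Set (Ω × Y))) (hRf : R.Finite) (hQf : Q.Finite)
    (hRp : IsCountablePartition G R) (hQp : IsCountablePartition G Q) :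
    partCondEntropy
        (MeasurableSpace.generateFrom Q ⊔ MeasurableSpace.comap Prod.fst inferInstance) μ R
      ≤ ENNReal.ofReal (∫ ω, Real.log (relCoverNum R Q ω : ℝ) ∂P) := by

  classical
  obtain ⟨-, hRm, hRG, hRd, hRU⟩ := hRp
  obtain ⟨-, hQm, hQG, hQd, hQU⟩ := hQp
  have hproj : ∀ q ∈ Q, ∀ r ∈ R, MeasurableSet {ω | (fib (q ∩ r) ω).Nonempty} :=
    fun q hq r hr => proj_meas P hP _ ((hQm q hq).inter (hRm r hr))
  have hNmeas := relCoverNum_meas G R Q hRf hQf hRd hRU hQG hproj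
  set m : MeasurableSpace (Ω × Y) :=
    MeasurableSpace.generateFrom Q ⊔ MeasurableSpace.comap Prod.fst inferInstance with hm
  have hmle : m ≤ Prod.instMeasurableSpace :=
    sup_le (MeasurableSpace.generateFrom_le hQm) measurable_fst.comap_le
  set N : Ω → ℕ := fun ω => relCoverNum R Q ω with hN
  have hcov : ∀ ω, ∀ q ∈ Q, coverNum q R ω ≤ max 1 R.ncard := by
    intro ω q hq
    rw [coverNum_eq G R hRf hRd hRU q (hQG q hq)]
    exact max_le_max le_rfl (Set.ncard_le_ncard (fun r hr => hr.1) hRf)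
  have hNle : ∀ ω, N ω ≤ max 1 R.ncard := fun ω => relCoverNum_le R Q ω _ (hcov ω)
  set e : Set (Ω × Y) → Ω × Y → ℝ := fun r => μ[r.indicator (fun _ => (1 : ℝ)) | m] with he
  have hint : ∀ r ∈ R, Integrable (r.indicator fun _ => (1 : ℝ)) μ := fun r hr =>
    (integrable_const _).indicator (hRm r hr)
  have he0 : ∀ r ∈ R, ∀ᵐ z ∂μ, 0 ≤ e r z := fun r hr =>
    condExp_nonneg (Eventually.of_forall fun z => indicator_nonneg (fun _ _ => zero_le_one) z)
  have hGae : ∀ᵐ z ∂μ, z ∈ G := (prob_compl_eq_zero_iff hG).2 hμG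
  have hsum : ∀ᵐ z ∂μ, ∑ r ∈ hRf.toFinset, e r z = 1 := by
    have h1 := condExp_finsetSum (μ := μ) (s := hRf.toFinset)
      (f := fun r : Set (Ω × Y) => r.indicator fun _ => (1 : ℝ))
      (fun r hr => hint r (hRf.mem_toFinset.1 hr)) m
    have h2 : (∑ r ∈ hRf.toFinset, r.indicator fun _ => (1 : ℝ)) =ᵐ[μ] fun _ => (1 : ℝ) := by
      filter_upwards [hGae] with z hz
      rw [← hRU] at hz
      obtain ⟨r, hr, hzr⟩ := hz
      rw [Finset.sum_apply, Finset.sum_eq_single r]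
      · simp [hzr]
      · intro r' hr' hne
        refine indicator_of_notMem (fun hz' => hne ?_) _
        exact hRd.elim (hRf.mem_toFinset.1 hr') hr (Set.not_disjoint_iff.2 ⟨z, hz', hzr⟩)
      · intro h; exact absurd (hRf.mem_toFinset.2 hr) h
    have h3 := condExp_congr_ae (m := m) h2
    rw [condExp_const hmle] at h3
    filter_upwards [h1, h3] with z hz1 hz3
    rw [hz1, Finset.sum_apply] at hz3
    exact hz3
  have hzero : ∀ q ∈ Q, ∀ r ∈ R, ∀ᵐ z ∂μ, z ∈ q → ¬ (fib (q ∩ r) z.1).Nonempty → e r z = 0 := by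
    intro q hq r hr
    set D : Set (Ω × Y) := q ∩ Prod.fst ⁻¹' {ω | (fib (q ∩ r) ω).Nonempty}ᶜ with hD
    have hDm : MeasurableSet[m] D := by
      refine MeasurableSet.inter ?_ ?_
      · exact (le_sup_left : _ ≤ m) _ (MeasurableSpace.measurableSet_generateFrom hq)
      · exact (le_sup_right : _ ≤ m) _ ⟨_, (hproj q hq r hr).compl, rfl⟩
    have hi := condExp_indicator (hint r hr) hDm
    have hz : D.indicator (r.indicator fun _ => (1 : ℝ)) = 0 := by
      funext z
      by_cases hzD : z ∈ D
      · rw [indicator_of_mem hzD]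
        refine indicator_of_notMem (fun hzr => hzD.2 ?_) _
        exact ⟨z.2, hzD.1, hzr⟩
      · exact indicator_of_notMem hzD _
    rw [hz, condExp_zero] at hi
    filter_upwards [hi] with z hz hzq hzn
    have hzD : z ∈ D := ⟨hzq, hzn⟩
    rw [indicator_of_mem hzD] at hz
    exact hz.symm
  have hzero' : ∀ᵐ z ∂μ, ∀ q ∈ Q, ∀ r ∈ R,
      z ∈ q → ¬ (fib (q ∩ r) z.1).Nonempty → e r z = 0 := by
    rw [ae_ball_iff hQf.countable]
    intro q hq
    rw [ae_ball_iff hRf.countable]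
    exact hzero q hq
  have he0' : ∀ᵐ z ∂μ, ∀ r ∈ R, 0 ≤ e r z := by
    rw [ae_ball_iff hRf.countable]; exact he0
  have he1 : ∀ᵐ z ∂μ, ∀ r ∈ R, e r z ≤ 1 := by
    filter_upwards [he0', hsum] with z h0 hs r hr
    rw [← hs]
    exact Finset.single_le_sum (f := fun r => e r z) (fun i hi => h0 i (hRf.mem_toFinset.1 hi))
      (hRf.mem_toFinset.2 hr)
  have hint' : ∀ r ∈ R, Integrable (fun z => Real.negMulLog (e r z)) μ := by
    intro r hr
    refine Integrable.of_bound (C := 1) ?_ ?_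
    · exact Real.continuous_negMulLog.comp_aestronglyMeasurable
        integrable_condExp.aestronglyMeasurable
    · filter_upwards [he0', he1] with z h0 h1
      rw [Real.norm_of_nonneg (Real.negMulLog_nonneg (h0 r hr) (h1 r hr))]
      have := Real.negMulLog_le_one_sub_self (h0 r hr)
      linarith [h0 r hr]
  have hnn : ∀ r ∈ R, 0 ≤ ∫ z, Real.negMulLog (e r z) ∂μ := by
    intro r hr
    refine integral_nonneg_of_ae ?_
    filter_upwards [he0', he1] with z h0 h1
    exact Real.negMulLog_nonneg (h0 r hr) (h1 r hr)
  have hpt : ∀ᵐ z ∂μ, ∑ r ∈ hRf.toFinset, Real.negMulLog (e r z) ≤ Real.log (N z.1) := by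
    filter_upwards [he0', hsum, hzero', hGae] with z h0 hs hz hzG
    rw [← hQU] at hzG
    obtain ⟨q, hq, hzq⟩ := hzG
    have hfin : (meet R q z.1).Finite := hRf.subset fun r hr => hr.1
    have hle := le_relCoverNum R Q z.1 _ (hcov z.1) q hq
    rw [coverNum_eq G R hRf hRd hRU q (hQG q hq)] at hle
    refine entropy_le hRf.toFinset (fun r => e r z) (fun r hr => h0 r (hRf.mem_toFinset.1 hr)) hs
      (N z.1) hfin.toFinset ?_ ?_ ((le_max_left _ _).trans hle) ?_
    · intro r hr
      exact hRf.mem_toFinset.2 (hfin.mem_toFinset.1 hr).1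
    · rw [← Set.ncard_eq_toFinset_card _ hfin]
      exact (le_max_right _ _).trans hle
    · intro r hr hrn
      have hr' := hRf.mem_toFinset.1 hr
      exact hz q hq r hr' hzq fun hne => hrn (hfin.mem_toFinset.2 ⟨hr', hne⟩)
  have hlogm : Measurable fun ω => Real.log (N ω : ℝ) :=
    (measurable_from_nat (f := fun n : ℕ => Real.log (n : ℝ))).comp hNmeas
  have hlogint : Integrable (fun z : Ω × Y => Real.log (N z.1 : ℝ)) μ := by
    refine Integrable.of_bound (C := Real.log (max 1 R.ncard : ℕ))
      (hlogm.comp measurable_fst).aestronglyMeasurable (Eventually.of_forall fun z => ?_)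
    rw [Real.norm_of_nonneg (Real.log_natCast_nonneg _)]
    rcases Nat.eq_zero_or_pos (N z.1) with h | h
    · rw [h]; simpa using Real.log_natCast_nonneg (max 1 R.ncard)
    · exact Real.log_le_log (by exact_mod_cast h) (by exact_mod_cast hNle z.1)
  have hI : ∫ ω, Real.log (N ω : ℝ) ∂P = ∫ z, Real.log (N z.1 : ℝ) ∂μ := by
    rw [← hμP]
    exact integral_map measurable_fst.aemeasurable hlogm.aestronglyMeasurable
  unfold partCondEntropy
  have : Fintype R := hRf.fintype
  rw [tsum_fintype, hI]
  have hts : ∑ r : R, ENNReal.ofReal (∫ z, Real.negMulLog (e r z) ∂μ)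
      = ∑ r ∈ hRf.toFinset, ENNReal.ofReal (∫ z, Real.negMulLog (e r z) ∂μ) :=
    (Finset.sum_subtype hRf.toFinset (fun r => hRf.mem_toFinset)
      (fun r => ENNReal.ofReal (∫ z, Real.negMulLog (e r z) ∂μ))).symm
  refine hts.le.trans ?_
  rw [← ENNReal.ofReal_sum_of_nonneg fun r hr => hnn r (hRf.mem_toFinset.1 hr),
    ← integral_finsetSum _ fun r hr => hint' r (hRf.mem_toFinset.1 hr)]
  exact ENNReal.ofReal_le_ofReal (integral_mono_ae
    (integrable_finsetSum _ fun r hr => hint' r (hRf.mem_toFinset.1 hr)) hlogint hpt)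

end RelTail
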